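/- A graph G is R-reduced if and only if there is no relation R with full domain (and image all of V_H) such that G∗R = H for some proper subgraph H of G. -/

import Mathlib

def srel {V B : Type*} (E : V → V → Prop) (R : V → B → Prop) : B → B → Prop :=
  fun u v => ∃ x y, E x y ∧ R x u ∧ R y v

def relPow {V : Type*} (R : V → V → Prop) : ℕ → V → V → Prop
  | 0 => fun x y => x = y
  | n + 1 => fun x y => ∃ z, relPow R n x z ∧ R z y

theorem relPow_iterate {V : Type*} (R : V → V → Prop) (f : V → V) (hf : ∀ x, R x (f x))
    (n : ℕ) (x : V) : relPow R n x (f^[n] x) := by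
  induction n with
  | zero => simp [relPow]
  | succ n ih =>
    rw [Function.iterate_succ_apply']
    exact ⟨_, ih, hf _⟩

theorem relPow_hom {V : Type*} (E R : V → V → Prop)
    (h : ∀ u v, srel E R u v → E u v) (n : ℕ) :
    ∀ x y u v, E x y → relPow R n x u → relPow R n y v → E u v := by
  induction n with
  | zero =>
    intro x y u v hxy hu hv
    simp only [relPow] at hu hv
    subst hu hv
    exact hxy
  | succ n ih =>
    rintro x y u v hxy ⟨z, hz, hzu⟩ ⟨w, hw, hwv⟩
    exact h u v ⟨z, w, ih x y z w hxy hz hw, hzu, hwv⟩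

theorem exists_idem_iterate {V : Type*} [Finite V] (f : V → V) :
    ∃ m : ℕ, ∀ x, f^[m + 1] (f^[m + 1] x) = f^[m + 1] x := by
  obtain ⟨a, b, hab, h⟩ : ∃ a b : ℕ, a < b ∧ f^[a] = f^[b] := by
    obtain ⟨a, b, hab, h⟩ := Finite.exists_ne_map_eq_of_infinite (fun n : ℕ => f^[n])
    rcases lt_or_gt_of_ne hab with h1 | h1
    · exact ⟨a, b, h1, h⟩
    · exact ⟨b, a, h1, h.symm⟩
  obtain ⟨d, rfl⟩ := Nat.exists_eq_add_of_lt hab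
  have key : ∀ k c, f^[c + a + k * (d + 1)] = f^[c + a] := by
    intro k
    induction k with
    | zero => intro c; simp
    | succ k ih =>
      intro c
      have e : c + a + (k + 1) * (d + 1) = (c + k * (d + 1)) + (a + d + 1) := by ring
      rw [e, Function.iterate_add, ← h, ← Function.iterate_add, ← ih c]
      congr 1
      ring
  refine ⟨a * (d + 1) + d, fun x => ?_⟩
  have e1 : a * (d + 1) + d + 1 = (a * d + d + 1) + a := by ring
  have e2 : (a * (d + 1) + d + 1) + (a * (d + 1) + d + 1)
      = (a * d + d + 1) + a + (a + 1) * (d + 1) := by ring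
  rw [← Function.iterate_add_apply, e2, key, e1]

/-- A graph `G` is R-reduced (admits no R-retraction to a proper subgraph) iff
there is no relation `R` with full domain and image all of `V_H` such that
`G ∗ R = H` for some proper subgraph `H` of `G`.  A subgraph of `G` is given by a
vertex set `S ⊆ V_G` and a symmetric edge relation `F ⊆ E_G` supported on `S`. -/
theorem stmt18 {V : Type*} [Fintype V] (E : V → V → Prop) (hE : Symmetric E) :
    -- G is R-reduced: no R-retraction of G to a proper subgraph
    (¬ ∃ (S : Set V) (F : V → V → Prop) (R : V → V → Prop),
        Symmetric F ∧
        (∀ x y, F x y → E x y ∧ x ∈ S ∧ y ∈ S) ∧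
        -- the subgraph is proper
        (¬ (S = Set.univ ∧ ∀ x y, F x y ↔ E x y)) ∧
        -- R is a relation from V_G to S, with full domain and image all of S
        (∀ x y, R x y → y ∈ S) ∧
        (∀ x : V, ∃ y, R x y) ∧
        (∀ y ∈ S, ∃ x, R x y) ∧
        -- G ∗ R = H
        (∀ u v, srel E R u v ↔ F u v) ∧
        -- R is a retraction: it fixes the subgraph pointwise
        (∀ x ∈ S, R x x)) ↔
    -- iff: no relation with full domain (and full image) from G to a proper subgraph
    (¬ ∃ (S : Set V) (F : V → V → Prop) (R : V → V → Prop),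
        Symmetric F ∧
        (∀ x y, F x y → E x y ∧ x ∈ S ∧ y ∈ S) ∧
        (¬ (S = Set.univ ∧ ∀ x y, F x y ↔ E x y)) ∧
        (∀ x y, R x y → y ∈ S) ∧
        (∀ x : V, ∃ y, R x y) ∧
        (∀ y ∈ S, ∃ x, R x y) ∧
        (∀ u v, srel E R u v ↔ F u v)) := by
  rw [not_iff_not]
  constructor
  · rintro ⟨S, F, R, h1, h2, h3, h4, h5, h6, h7, -⟩
    exact ⟨S, F, R, h1, h2, h3, h4, h5, h6, h7⟩
  · rintro ⟨S, F, R, h1, h2, h3, h4, h5, h6, h7⟩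
    choose f hf using h5
    obtain ⟨m, hm⟩ := exists_idem_iterate f
    have hRE : ∀ u v, srel E R u v → E u v := fun u v h => (h2 u v ((h7 u v).1 h)).1
    have hom := relPow_hom E R hRE
    have hit := relPow_iterate R f hf (m + 1)
    refine ⟨{x | relPow R (m + 1) x x},
      fun x y => E x y ∧ relPow R (m + 1) x x ∧ relPow R (m + 1) y y,
      fun x y => relPow R (m + 1) x y ∧ relPow R (m + 1) y y,
      ?_, fun x y h => h, ?_, fun x y h => h.2, ?_, fun y hy => ⟨y, hy, hy⟩, ?_,
      fun x hx => ⟨hx, hx⟩⟩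
    · rintro x y ⟨h, hx, hy⟩
      exact ⟨hE h, hy, hx⟩
    · rintro ⟨hT, -⟩
      have hrefl : ∀ x, relPow R (m + 1) x x := fun x => by
        have : x ∈ {x | relPow R (m + 1) x x} := hT ▸ Set.mem_univ x
        exact this
      apply h3
      refine ⟨Set.eq_univ_of_forall fun x => ?_, fun x y => ⟨fun h => (h2 x y h).1, fun h => ?_⟩⟩
      · obtain ⟨z, -, hz⟩ := hrefl x
        exact h4 _ _ hz
      · obtain ⟨z, hz, hzx⟩ := hrefl x
        obtain ⟨w, hw, hwy⟩ := hrefl y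
        exact (h7 x y).1 ⟨z, w, hom m x y z w h hz hw, hzx, hwy⟩
    · intro x
      refine ⟨f^[m + 1] x, hit x, ?_⟩
      have := hit (f^[m + 1] x)
      rwa [hm] at this
    · intro u v
      constructor
      · rintro ⟨x, y, hxy, ⟨hxu, hu⟩, ⟨hyv, hv⟩⟩
        exact ⟨hom _ x y u v hxy hxu hyv, hu, hv⟩
      · rintro ⟨h, hu, hv⟩
        exact ⟨u, v, h, ⟨hu, hu⟩, ⟨hv, hv⟩⟩
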